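/- Let A and B be symmetric n×n matrices with A negative semi-definite, B ∈ Γ_k^+, and A + B ∈ Γ_k^+. Then σ_k(A + B) ≤ σ_k(B). -/

import Mathlib

open Matrix Finset

/-- The `k`-th elementary symmetric polynomial of `x : Fin n → ℝ`. -/
noncomputable def esym (n k : ℕ) (x : Fin n → ℝ) : ℝ :=
  ∑ s ∈ Finset.powersetCard k (Finset.univ : Finset (Fin n)), ∏ i ∈ s, x i

/-- `σ_k(A)`: the `k`-th elementary symmetric polynomial of the eigenvalues of a
symmetric (Hermitian) real matrix `A` (junk value `0` otherwise). -/
noncomputable def msigma {n : ℕ} (k : ℕ) (A : Matrix (Fin n) (Fin n) ℝ) : ℝ :=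
  if h : A.IsHermitian then esym n k h.eigenvalues else 0

/-- The `q`-th Newton transformation `T_q(A) = ∑_{i=0}^q (-1)^i σ_{q-i}(A) A^i`. -/
noncomputable def newton {n : ℕ} (q : ℕ) (A : Matrix (Fin n) (Fin n) ℝ) :
    Matrix (Fin n) (Fin n) ℝ :=
  ∑ i ∈ Finset.range (q + 1), ((-1 : ℝ) ^ i * msigma (q - i) A) • A ^ i

/-- `Γ_k^+ ⊆ ℝ^n`: the connected component of `{σ_k > 0}` containing the positive cone
(equivalently, containing the point `(1,…,1)`). -/
def Gamma (n k : ℕ) : Set (Fin n → ℝ) :=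
  connectedComponentIn {x : Fin n → ℝ | 0 < esym n k x} (fun _ => 1)

/-- A symmetric matrix lies in `Γ_k^+` if its eigenvalue vector does. -/
def inGamma (n k : ℕ) (A : Matrix (Fin n) (Fin n) ℝ) : Prop :=
  ∃ h : A.IsHermitian, h.eigenvalues ∈ Gamma n k

open Polynomial in
/-- A real-rooted real polynomial has a real-rooted derivative (Rolle). -/
theorem Polynomial.Splits.derivative_real {p : ℝ[X]} (hp : p.Splits) :
    (derivative p).Splits := by
  rw [splits_iff_card_roots] at hp ⊢
  have h1 := card_roots_le_derivative p
  have h2 := card_roots' (derivative p)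
  have h3 := natDegree_derivative_le p
  rcases Nat.eq_zero_or_pos p.natDegree with h0 | h0
  · rw [eq_C_of_natDegree_eq_zero h0]
    simp
  · omega

open Polynomial in
theorem Polynomial.Splits.iterate_derivative_real {p : ℝ[X]} (hp : p.Splits) (m : ℕ) :
    (derivative^[m] p).Splits := by
  induction m with
  | zero => simpa
  | succ m ih =>
    rw [Function.iterate_succ_apply']
    exact ih.derivative_real

open Polynomial in
theorem coeff_prod_X_sub_C_pos (S : Multiset ℝ) (hS : ∀ a ∈ S, a < 0) (i : ℕ) :
    0 ≤ (S.map fun a => X - C a).prod.coeff i ∧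
      (i ≤ Multiset.card S → 0 < (S.map fun a => X - C a).prod.coeff i) := by
  induction S using Multiset.induction_on generalizing i with
  | empty =>
    simp only [Multiset.map_zero, Multiset.prod_zero, coeff_one, Multiset.card_zero]
    split_ifs <;> simp_all
  | cons a S ih =>
    have ha : a < 0 := hS a (Multiset.mem_cons_self a S)
    have ih := ih fun b hb => hS b (Multiset.mem_cons_of_mem hb)
    rw [Multiset.map_cons, Multiset.prod_cons, sub_mul, coeff_sub, coeff_C_mul]
    cases i with
    | zero =>
      have := (ih 0).2 (Nat.zero_le _)
      rw [coeff_X_mul_zero]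
      have : 0 < 0 - a * (S.map fun a => X - C a).prod.coeff 0 := by nlinarith
      exact ⟨this.le, fun _ => this⟩
    | succ i =>
      have h1 := (ih (i + 1)).1
      rw [coeff_X_mul, Multiset.card_cons]
      refine ⟨by nlinarith [(ih i).1], fun hi => ?_⟩
      nlinarith [(ih i).2 (by omega)]

open Polynomial in
/-- A real-rooted polynomial with nonnegative coefficients and positive constant term has
positive coefficients up to its degree. -/
theorem Polynomial.Splits.coeff_pos {p : ℝ[X]} (hp : p.Splits) (hnn : ∀ i, 0 ≤ p.coeff i)
    (h0 : 0 < p.coeff 0) {i : ℕ} (hi : i ≤ p.natDegree) : 0 < p.coeff i := by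
  have hp0 : p ≠ 0 := by
    rintro rfl
    simp at h0
  have hroots : ∀ a ∈ p.roots, a < 0 := by
    intro a ha
    by_contra! hneg
    have hr : p.eval a = 0 := (mem_roots hp0).1 ha
    rw [eval_eq_sum_range, Finset.sum_range_succ'] at hr
    have : 0 ≤ ∑ k ∈ Finset.range p.natDegree, p.coeff (k + 1) * a ^ (k + 1) :=
      Finset.sum_nonneg fun k _ => mul_nonneg (hnn _) (pow_nonneg hneg _)
    simp only [pow_zero, mul_one] at hr
    linarith
  have hlead : 0 < p.leadingCoeff :=
    lt_of_le_of_ne (hnn _) (Ne.symm (leadingCoeff_ne_zero.2 hp0))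
  rw [hp.eq_prod_roots, coeff_C_mul]
  exact mul_pos hlead ((coeff_prod_X_sub_C_pos _ hroots i).2
    (by rwa [splits_iff_card_roots.1 hp]))

/-- The `j`-th elementary symmetric function of the entries of `x` indexed by `s`. -/
noncomputable def esymOn {ι : Type*} (s : Finset ι) (j : ℕ) (x : ι → ℝ) : ℝ :=
  ∑ t ∈ s.powersetCard j, ∏ i ∈ t, x i

open Polynomial in
theorem esymOn_pos_of_nonneg {ι : Type*} (s : Finset ι) (x : ι → ℝ) {m : ℕ}
    (hnn : ∀ j < m, 0 ≤ esymOn s j x) (hm : 0 < esymOn s m x) {j : ℕ} (hj : j ≤ m) :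
    0 < esymOn s j x := by
  have hms : m ≤ #s := by
    by_contra! h
    rw [esymOn, Finset.powersetCard_eq_empty.2 h] at hm
    simp at hm
  set P : ℝ[X] := ∏ i ∈ s, (X + C (x i)) with hP
  have hPs : P.Splits := Splits.prod fun i _ => Splits.X_add_C _
  have hPd : P.natDegree = #s := by
    rw [hP, natDegree_prod_of_monic _ _ fun i _ => monic_X_add_C _]
    simp
  set Q := derivative^[#s - m] P with hQ
  have hcoeff : ∀ i ≤ m, Q.coeff i =
      ((i + (#s - m)).descFactorial (#s - m) : ℝ) * esymOn s (m - i) x := by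
    intro i hi
    have hdeg : #s - (i + (#s - m)) = m - i := by omega
    rw [hQ, coeff_iterate_derivative, nsmul_eq_mul, hP,
      Finset.prod_X_add_C_coeff s x (by omega), hdeg, esymOn]
  have hfac : ∀ i, 0 < ((i + (#s - m)).descFactorial (#s - m) : ℝ) := fun i => by
    exact_mod_cast Nat.descFactorial_pos.2 (by omega)
  have h0 : 0 < Q.coeff 0 := by
    rw [hcoeff 0 (Nat.zero_le _)]
    exact mul_pos (hfac 0) hm
  have hQnn : ∀ i, 0 ≤ Q.coeff i := by
    intro i
    rcases le_or_gt i m with hi | hi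
    · rcases Nat.eq_zero_or_pos i with rfl | hi0
      · exact h0.le
      · rw [hcoeff i hi]
        exact mul_nonneg (hfac i).le (hnn _ (by omega))
    · rw [hQ, coeff_iterate_derivative, coeff_eq_zero_of_natDegree_lt (by omega)]
      simp
  have hQm : Q.coeff m ≠ 0 := by
    rw [hcoeff m le_rfl]
    simp [esymOn]
  have hpos := (hPs.iterate_derivative_real (#s - m)).coeff_pos hQnn h0
    (i := m - j) ((Nat.sub_le _ _).trans (le_natDegree_of_ne_zero hQm))
  rw [← hQ, hcoeff _ (Nat.sub_le _ _), Nat.sub_sub_self hj] at hpos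
  exact pos_of_mul_pos_right hpos (hfac _).le

theorem esymOn_insert {ι : Type*} [DecidableEq ι] {s : Finset ι} {i : ι} (hi : i ∉ s) (k : ℕ)
    (x : ι → ℝ) :
    esymOn (insert i s) (k + 1) x = esymOn s (k + 1) x + x i * esymOn s k x := by
  have hnot : ∀ t ∈ s.powersetCard k, i ∉ t := fun t ht hit =>
    hi ((Finset.mem_powersetCard.1 ht).1 hit)
  rw [esymOn, Finset.powersetCard_succ_insert hi, Finset.sum_union, Finset.sum_image]
  · simp only [esymOn, Finset.mul_sum]
    congr 1
    exact Finset.sum_congr rfl fun t ht => Finset.prod_insert (hnot t ht)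
  · intro t ht u hu h
    rw [← Finset.erase_insert (hnot t ht), ← Finset.erase_insert (hnot u hu), h]
  · rw [Finset.disjoint_left]
    intro t ht ht'
    obtain ⟨u, -, rfl⟩ := Finset.mem_image.1 ht'
    exact hi ((Finset.mem_powersetCard.1 ht).1 (Finset.mem_insert_self _ _))

@[fun_prop]
theorem continuous_esymOn {ι : Type*} (s : Finset ι) (j : ℕ) : Continuous (esymOn s j) := by
  unfold esymOn
  fun_prop

theorem esymOn_congr {ι : Type*} {s : Finset ι} {x y : ι → ℝ} (h : ∀ i ∈ s, x i = y i) (j : ℕ) :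
    esymOn s j x = esymOn s j y :=
  Finset.sum_congr rfl fun _ ht => Finset.prod_congr rfl fun i hi =>
    h i ((Finset.mem_powersetCard.1 ht).1 hi)

theorem esym_succ {n : ℕ} (k : ℕ) (x : Fin n → ℝ) (i : Fin n) :
    esym n (k + 1) x = esymOn (univ.erase i) (k + 1) x + x i * esymOn (univ.erase i) k x := by
  rw [← esymOn_insert (Finset.notMem_erase i _), Finset.insert_erase (Finset.mem_univ i)]
  rfl

/-- On `Γ_{k+1}^+` the `i`-th partial derivative `σ_k(x|i)` of `σ_{k+1}` is positive. -/
theorem esymOn_erase_pos_of_mem_Gamma {n k : ℕ} (hk : k + 1 ≤ n) (i : Fin n) {x : Fin n → ℝ}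
    (hx : x ∈ Gamma n (k + 1)) : 0 < esymOn (univ.erase i) k x := by
  set s : Finset (Fin n) := univ.erase i with hs
  have hcard : #s = n - 1 := by simp [hs]
  have hdom := connectedComponentIn_subset {x : Fin n → ℝ | 0 < esym n (k + 1) x} (fun _ => 1)
  let U : Set (Fin n → ℝ) := {y | ∀ j ∈ Finset.range (k + 1), 0 < esymOn s j y}
  have hU : IsOpen U := by
    have : U = ⋂ j ∈ Finset.range (k + 1), {y | 0 < esymOn s j y} := by
      ext
      simp [U]
    rw [this]
    exact isOpen_biInter_finset fun j _ => isOpen_lt continuous_const (continuous_esymOn s j)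
  have hone : ∀ {m j : ℕ} (t : Finset (Fin m)), j ≤ #t → 0 < esymOn t j fun _ => (1 : ℝ) := by
    intro m j t hj
    simpa [esymOn] using Nat.choose_pos hj
  have hmem : (fun _ => (1 : ℝ)) ∈ Gamma n (k + 1) :=
    mem_connectedComponentIn (hone univ (by simpa using hk))
  have hsub : Gamma n (k + 1) ⊆ U := by
    refine isPreconnected_connectedComponentIn.subset_of_closure_inter_subset hU
      ⟨_, hmem, fun j hj => hone s ?_⟩ ?_
    · have := Finset.mem_range.1 hj
      omega
    · rintro y ⟨hyc, hyG⟩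
      have hnn : ∀ j ≤ k, 0 ≤ esymOn s j y := by
        intro j hj
        have hcl : IsClosed {y : Fin n → ℝ | 0 ≤ esymOn s j y} :=
          isClosed_le continuous_const (continuous_esymOn s j)
        exact closure_minimal
          (fun z hz => (hz j (Finset.mem_range.2 (by omega))).le) hcl hyc
      have hpos : 0 < esym n (k + 1) y := hdom hyG
      have hk0 : 0 < esymOn s k y := by
        refine lt_of_le_of_ne (hnn k le_rfl) fun h0 => ?_
        rw [esym_succ k y i, ← hs, ← h0, mul_zero, add_zero] at hpos
        exact (esymOn_pos_of_nonneg s y (fun j hj => hnn j (by omega)) hpos (Nat.le_succ k)).ne h0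
      intro j hj
      have := Finset.mem_range.1 hj
      exact esymOn_pos_of_nonneg s y (fun j hj => hnn j hj.le) hk0 (by omega)
  exact hsub hx k (Finset.mem_range.2 (Nat.lt_succ_self k))

/-- Increasing one coordinate preserves `Γ_{k+1}^+` and does not decrease `σ_{k+1}`. -/
theorem update_mem_Gamma {n k : ℕ} (hk : k + 1 ≤ n) {x : Fin n → ℝ} (hx : x ∈ Gamma n (k + 1))
    (i : Fin n) {a : ℝ} (ha : x i ≤ a) :
    Function.update x i a ∈ Gamma n (k + 1) ∧
      esym n (k + 1) x ≤ esym n (k + 1) (Function.update x i a) := by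
  have hp := esymOn_erase_pos_of_mem_Gamma hk i hx
  have hmono : ∀ b, x i ≤ b → esym n (k + 1) x ≤ esym n (k + 1) (Function.update x i b) := by
    intro b hb
    have hc : ∀ j, esymOn (univ.erase i) j (Function.update x i b) = esymOn (univ.erase i) j x :=
      esymOn_congr fun l hl => Function.update_of_ne (Finset.ne_of_mem_erase hl) _ _
    rw [esym_succ k x i, esym_succ k _ i, hc, hc, Function.update_self]
    nlinarith
  refine ⟨?_, hmono a ha⟩
  have hx0 : 0 < esym n (k + 1) x :=
    connectedComponentIn_subset {x : Fin n → ℝ | 0 < esym n (k + 1) x} _ hx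
  have hpre : IsPreconnected (Function.update x i '' Set.Icc (x i) a) :=
    isPreconnected_Icc.image _ (Continuous.continuousOn (by fun_prop))
  have hsub := hpre.subset_connectedComponentIn (F := {x | 0 < esym n (k + 1) x}) (x := x)
    ⟨x i, Set.left_mem_Icc.2 ha, Function.update_eq_self i x⟩ (by
      rintro _ ⟨b, hb, rfl⟩
      exact hx0.trans_le (hmono b hb.1))
  rw [Gamma, connectedComponentIn_eq hx]
  exact hsub ⟨a, Set.right_mem_Icc.2 ha, rfl⟩

/-- `σ_{k+1}` is monotone on `Γ_{k+1}^+` for the coordinatewise order. -/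
theorem esym_le_of_mem_Gamma {n k : ℕ} (hk : k + 1 ≤ n) {x y : Fin n → ℝ}
    (hx : x ∈ Gamma n (k + 1)) (hxy : x ≤ y) : esym n (k + 1) x ≤ esym n (k + 1) y := by
  have key : ∀ s : Finset (Fin n), s.piecewise y x ∈ Gamma n (k + 1) ∧
      esym n (k + 1) x ≤ esym n (k + 1) (s.piecewise y x) := by
    intro s
    induction s using Finset.induction_on with
    | empty => simpa using hx
    | insert i s hi ih =>
      rw [Finset.piecewise_insert]
      have h := update_mem_Gamma hk ih.1 i (a := y i) (by simpa [hi] using hxy i)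
      exact ⟨h.1, ih.2.trans h.2⟩
  simpa using (key univ).2

open scoped InnerProductSpace

theorem Matrix.IsHermitian.dotProduct_mulVec_eq_sum {ι : Type*} [Fintype ι] [DecidableEq ι]
    {A : Matrix ι ι ℝ} (hA : A.IsHermitian) (v : EuclideanSpace ℝ ι) :
    v ⬝ᵥ (A *ᵥ v) = ∑ j, hA.eigenvalues j * ⟪hA.eigenvectorBasis j, v⟫_ℝ ^ 2 := by
  have hin : ∀ u w : EuclideanSpace ℝ ι, ⟪u, w⟫_ℝ = u ⬝ᵥ w := fun u w => by
    simp [EuclideanSpace.inner_eq_star_dotProduct, dotProduct_comm]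
  have hv : v ⬝ᵥ (A *ᵥ v) = ⟪v, WithLp.toLp 2 (A *ᵥ v)⟫_ℝ :=
    (hin v (WithLp.toLp 2 (A *ᵥ v))).symm
  rw [hv, ← hA.eigenvectorBasis.sum_inner_mul_inner]
  refine Finset.sum_congr rfl fun j _ => ?_
  have hAt : Aᵀ = A := by simpa using hA.eq
  have : ⟪hA.eigenvectorBasis j, WithLp.toLp 2 (A *ᵥ v)⟫_ℝ =
      hA.eigenvalues j * ⟪hA.eigenvectorBasis j, v⟫_ℝ := by
    rw [hin, hin, dotProduct_mulVec, ← mulVec_transpose, hAt, hA.mulVec_eigenvectorBasis,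
      smul_dotProduct, smul_eq_mul]
  rw [this, real_inner_comm]
  ring

/-- Weyl monotonicity: adding a positive semidefinite matrix does not decrease the ordered
eigenvalues. -/
theorem Matrix.IsHermitian.eigenvalues_le_of_posSemidef_sub {ι : Type*} [Fintype ι]
    [DecidableEq ι] {A B : Matrix ι ι ℝ} (hA : A.IsHermitian) (hB : B.IsHermitian)
    (hAB : (B - A).PosSemidef) : hA.eigenvalues ≤ hB.eigenvalues := by
  intro i
  let e : ι ≃ Fin (Fintype.card ι) := (Fintype.equivOfCardEq (Fintype.card_fin _)).symm
  have anti : ∀ {M : Matrix ι ι ℝ} (hM : M.IsHermitian) {j l : ι}, e j ≤ e l →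
      hM.eigenvalues l ≤ hM.eigenvalues j := fun hM _ _ h => hM.eigenvalues₀_antitone h
  let u : ι → EuclideanSpace ℝ ι := fun j =>
    if e i < e j then hA.eigenvectorBasis j else hB.eigenvectorBasis j
  let f : EuclideanSpace ℝ ι →ₗ[ℝ] ({j // j ≠ i} → ℝ) :=
    LinearMap.pi fun j => (innerₛₗ ℝ (u j))
  have hker : LinearMap.ker f ≠ ⊥ := by
    apply LinearMap.ker_ne_bot_of_finrank_lt
    have : 0 < Fintype.card ι := Fintype.card_pos_iff.2 ⟨i⟩
    simpa [Fintype.card_subtype_compl] using this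
  obtain ⟨v, hv, hv0⟩ := Submodule.exists_mem_ne_zero_of_ne_bot hker
  have hu : ∀ j, j ≠ i → ⟪u j, v⟫_ℝ = 0 := fun j hj =>
    congrFun (LinearMap.mem_ker.1 hv) ⟨j, hj⟩
  have hlow : hA.eigenvalues i * ‖v‖ ^ 2 ≤ v ⬝ᵥ (A *ᵥ v) := by
    rw [hA.dotProduct_mulVec_eq_sum, ← hA.eigenvectorBasis.sum_sq_inner_right v, Finset.mul_sum]
    refine Finset.sum_le_sum fun j _ => ?_
    rcases lt_or_ge (e i) (e j) with h | h
    · have := hu j (by rintro rfl; exact lt_irrefl _ h)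
      simp only [u, if_pos h] at this
      simp [this]
    · exact mul_le_mul_of_nonneg_right (anti hA h) (sq_nonneg _)
  have hup : v ⬝ᵥ (B *ᵥ v) ≤ hB.eigenvalues i * ‖v‖ ^ 2 := by
    rw [hB.dotProduct_mulVec_eq_sum, ← hB.eigenvectorBasis.sum_sq_inner_right v, Finset.mul_sum]
    refine Finset.sum_le_sum fun j _ => ?_
    rcases lt_or_ge (e j) (e i) with h | h
    · have := hu j (by rintro rfl; exact lt_irrefl _ h)
      simp only [u, if_neg h.not_gt] at this
      simp [this]
    · exact mul_le_mul_of_nonneg_right (anti hB h) (sq_nonneg _)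
  have hmid : v ⬝ᵥ (A *ᵥ v) ≤ v ⬝ᵥ (B *ᵥ v) := by
    have := hAB.dotProduct_mulVec_nonneg v
    simpa [sub_mulVec, dotProduct_sub] using this
  exact le_of_mul_le_mul_right (hlow.trans (hmid.trans hup)) (by positivity)

/-- If `A` is negative semi-definite, `B ∈ Γ_k^+` and `A + B ∈ Γ_k^+`, then
`σ_k(A + B) ≤ σ_k(B)`. -/
theorem sigma_add_le {n k : ℕ} (h1 : 1 ≤ k) (hk : k ≤ n)
    (A B : Matrix (Fin n) (Fin n) ℝ) (hA : (-A).PosSemidef)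
    (hB : inGamma n k B) (hAB : inGamma n k (A + B)) :
    msigma k (A + B) ≤ msigma k B := by
  obtain ⟨hBh, -⟩ := hB
  obtain ⟨hABh, hmem⟩ := hAB
  obtain ⟨k, rfl⟩ := Nat.exists_eq_add_of_le' h1
  rw [msigma, msigma, dif_pos hABh, dif_pos hBh]
  exact esym_le_of_mem_Gamma hk hmem
    (hABh.eigenvalues_le_of_posSemidef_sub hBh (by simpa using hA))
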